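/- Let g ∈ ℝ² be the GBS horizontal location and let R(u) = B · log₂(1 + γ / (‖u − g‖² + H²)) with B > 0, γ > 0, H > 0, and fix V_max > 0 and a, b ∈ ℝ². Let T > 0 and let u : ℝ → ℝ² be V_max-Lipschitz on [0, T] with u(0) = a, u(T) = b, and suppose the trajectory never passes through the GBS location, i.e., u(t) ≠ g for all t ∈ [0, T]. Then there exists a map u' : ℝ → ℝ² with u'(0) = a, u'(T) = b, which is V_max-Lipschitz on [0, T] and travels at constant speed V_max (i.e., for all 0 ≤ s ≤ t ≤ T, the arc length of u' over [s, t] equals V_max · (t − s)), such that ∫₀ᵀ R(u'(t)) dt ≥ ∫₀ᵀ R(u(t)) dt. (This is the content of Proposition 2: when the required data volume is strictly between the straight-line volume D_T and the no-hover rate-oriented volume D_R(0) — in which case the optimal path does not traverse g — the optimal trajectory for the per-stage subproblem has constant speed V_max.) -/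

import Mathlib

/-- The achievable rate when the UAV is at horizontal position `u`, with GBS at `g`,
bandwidth `B`, reference SNR `γ`, and altitude difference `H`. -/
noncomputable def rate (B γ H : ℝ) (g u : EuclideanSpace ℝ (Fin 2)) : ℝ :=
  B * Real.logb 2 (1 + γ / (‖u - g‖ ^ 2 + H ^ 2))

open MeasureTheory Set Filter Topology

/-- Integral of a bounded measurable function. -/
lemma bdd_int {E : Type*} [NormedAddCommGroup E] [NormedSpace ℝ E] [CompleteSpace E]
    {f : ℝ → E} {C : ℝ} (hm : AEStronglyMeasurable f volume) (hC : ∀ᵐ x, ‖f x‖ ≤ C) :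
    LocallyIntegrable f volume := by
  intro x
  refine ⟨Icc (x-1) (x+1), Icc_mem_nhds (by linarith) (by linarith), ?_⟩
  refine Measure.integrableOn_of_bounded (M := C) (by simp) hm (ae_restrict_of_ae hC)

lemma li_ii {E : Type*} [NormedAddCommGroup E] {f : ℝ → E}
    (h : LocallyIntegrable f volume) (a b : ℝ) : IntervalIntegrable f volume a b :=
  (h.integrableOn_isCompact isCompact_uIcc).intervalIntegrable

lemma bdd_lip {E : Type*} [NormedAddCommGroup E] [NormedSpace ℝ E] [CompleteSpace E]
    {f : ℝ → E} {C : NNReal} (hm : AEStronglyMeasurable f volume) (hC : ∀ᵐ x, ‖f x‖ ≤ C) :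
    LipschitzWith C (fun t => ∫ x in (0:ℝ)..t, f x) := by
  have h := li_ii (bdd_int hm hC)
  refine LipschitzWith.of_dist_le_mul fun s t => ?_
  rw [dist_eq_norm, intervalIntegral.integral_interval_sub_left (h _ _) (h _ _), Real.dist_eq]
  refine intervalIntegral.norm_integral_le_of_norm_le_const_ae ?_
  filter_upwards [hC] with x hx _ using hx

lemma lip_of_ac {Y : ℝ → ℂ} {V : NNReal} (hac : ∀ a b, AbsolutelyContinuousOnInterval Y a b)
    (hd : ∀ᵐ x, DifferentiableAt ℝ Y x) (hV : ∀ᵐ x, ‖deriv Y x‖ ≤ V) : LipschitzWith V Y := by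
  have hm : AEStronglyMeasurable (deriv Y) volume := (measurable_deriv Y).aestronglyMeasurable
  have hlip := bdd_lip hm hV
  have hli := LocallyIntegrable.ae_hasDerivAt_integral (bdd_int hm hV)
  refine LipschitzWith.of_dist_le_mul fun s t => ?_
  have hg : AbsolutelyContinuousOnInterval (fun x => Y x - ∫ u in (0:ℝ)..x, deriv Y u) s t :=
    (hac s t).sub (hlip.lipschitzOnWith).absolutelyContinuousOnInterval
  obtain ⟨c, hc⟩ := hg.const_of_ae_hasDerivAt_zero (by
    filter_upwards [hd, hli] with x h1 h2 _
    have h3 := h1.hasDerivAt.sub (h2 0)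
    rw [sub_self] at h3
    exact h3)
  have h1 := hc s left_mem_uIcc
  have h2 := hc t right_mem_uIcc
  have := hlip.dist_le_mul s t
  rw [dist_eq_norm] at this ⊢
  convert this using 2
  linear_combination h1 - h2

lemma exp_ac {f : ℝ → ℂ} {C : NNReal} (hm : Measurable f) (hC : ∀ x, ‖f x‖ ≤ C) (a b : ℝ) :
    AbsolutelyContinuousOnInterval (fun t => Complex.exp (∫ x in (0:ℝ)..t, f x)) a b := by
  have hl := bdd_lip hm.aestronglyMeasurable (ae_of_all _ hC)
  obtain ⟨R, hR⟩ := (isCompact_uIcc (a := a) (b := b)).exists_bound_of_continuousOn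
    hl.continuous.continuousOn
  obtain ⟨K, hK⟩ := (Complex.contDiff_exp (𝕜 := ℝ) (n := 1)).contDiffOn.exists_lipschitzOnWith
    (by decide) (convex_closedBall (0:ℂ) R) (isCompact_closedBall _ _)
  refine LipschitzOnWith.absolutelyContinuousOnInterval (K := K * C) ?_
  exact hK.comp hl.lipschitzOnWith (fun x hx => by simpa using hR x hx)

lemma exp_deriv {f : ℝ → ℂ} {C : NNReal} (hm : Measurable f) (hC : ∀ x, ‖f x‖ ≤ C) :
    ∀ᵐ t, HasDerivAt (fun t => Complex.exp (∫ x in (0:ℝ)..t, f x))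
      (Complex.exp (∫ x in (0:ℝ)..t, f x) * f t) t := by
  filter_upwards [LocallyIntegrable.ae_hasDerivAt_integral
    (bdd_int hm.aestronglyMeasurable (ae_of_all _ hC))]
    with t ht
  exact (ht 0).cexp

lemma var_eq {y : ℝ → ℂ} {V : NNReal} (hy : LipschitzWith V y)
    (hd : ∀ᵐ x, ∃ d, HasDerivAt y d x ∧ ‖d‖ = V) {s t : ℝ} (hst : s ≤ t) :
    eVariationOn y (Icc s t) = ENNReal.ofReal (V * (t - s)) := by
  have hub : ∀ s t : ℝ, s ≤ t → eVariationOn y (Icc s t) ≤ ENNReal.ofReal (V * (t - s)) := by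
    intro s t hst
    have h1 := (hy.lipschitzOnWith (s := univ)).comp_eVariationOn_le (g := id) (s := Icc s t)
      (fun _ _ => mem_univ _)
    have h2 := (monotoneOn_id (s := Icc s t)).eVariationOn_eq (left_mem_Icc.2 hst)
      (right_mem_Icc.2 hst)
    rw [inter_self] at h2
    refine h1.trans ?_
    rw [ENNReal.ofReal_mul V.coe_nonneg, ENNReal.ofReal_coe_nnreal]
    gcongr
    exact h2.le
  refine le_antisymm (hub s t hst) ?_
  have hbv : LocallyBoundedVariationOn y univ := by
    intro a b _ _
    rw [univ_inter]
    rcases le_total a b with h | h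
    · exact ne_top_of_le_ne_top ENNReal.ofReal_ne_top (hub a b h)
    · have : (Icc a b).Subsingleton := by
        intro x hx z hz
        linarith [hx.1, hx.2, hz.1, hz.2]
      exact BoundedVariationOn.of_subsingleton this
  set L : ℝ → ℝ := variationOnFromTo y univ 0 with hL
  have hLd : ∀ a b, a ≤ b → L b - L a = (eVariationOn y (Icc a b)).toReal := by
    intro a b hab
    rw [hL, variationOnFromTo.sub_right hbv (mem_univ _) (mem_univ _) (mem_univ _),
      variationOnFromTo.eq_of_le _ _ hab, univ_inter]
  have hfin : ∀ a b, a ≤ b → eVariationOn y (Icc a b) ≠ ⊤ := fun a b h =>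
    ne_top_of_le_ne_top ENNReal.ofReal_ne_top (hub a b h)
  have hLlip : LipschitzWith V L := by
    refine LipschitzWith.of_le_add_mul V fun x x' => ?_
    rcases le_total x x' with h | h
    · have := hLd x x' h
      have h3 : 0 ≤ (eVariationOn y (Icc x x')).toReal := ENNReal.toReal_nonneg
      have : 0 ≤ (V:ℝ) * dist x x' := by positivity
      linarith
    · have := hLd x' x h
      have h3 : (eVariationOn y (Icc x' x)).toReal ≤ V * (x - x') :=
        ENNReal.toReal_le_of_le_ofReal (mul_nonneg V.2 (by linarith)) (hub _ _ h)
      rw [Real.dist_eq, abs_of_nonneg (by linarith)]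
      linarith
  have hLac : AbsolutelyContinuousOnInterval L s t :=
    hLlip.lipschitzOnWith.absolutelyContinuousOnInterval
  have hder : ∀ᵐ x, (V:ℝ) ≤ deriv L x := by
    filter_upwards [hLlip.ae_differentiableAt, hd] with x h1 ⟨d, h2, h3⟩
    have e1 := (hasDerivAt_iff_tendsto_slope_left_right.1 h1.hasDerivAt).2
    have e2 := (hasDerivAt_iff_tendsto_slope_left_right.1 h2).2.norm
    rw [← h3]
    refine le_of_tendsto_of_tendsto e2 e1 ?_
    filter_upwards [self_mem_nhdsWithin] with b hb
    have hb : x < b := hb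
    rw [slope_def_field, hLd x b hb.le, slope_def_module, norm_smul, norm_inv, Real.norm_eq_abs,
      abs_of_pos (sub_pos.2 hb), inv_mul_eq_div]
    rw [div_le_div_iff_of_pos_right (sub_pos.2 hb)]
    have := ENNReal.toReal_mono (hfin x b hb.le)
      (eVariationOn.edist_le y (right_mem_Icc.2 hb.le) (left_mem_Icc.2 hb.le))
    rwa [edist_dist, ENNReal.toReal_ofReal dist_nonneg, dist_eq_norm] at this
  have hI := hLac.integral_deriv_eq_sub
  have hmono : ∫ x in s..t, (V:ℝ) ≤ ∫ x in s..t, deriv L x :=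
    intervalIntegral.integral_mono_ae hst (by simp) hLac.intervalIntegrable_deriv hder
  rw [hI, hLd s t hst, intervalIntegral.integral_const, smul_eq_mul] at hmono
  rw [← ENNReal.ofReal_toReal (hfin s t hst)]
  apply ENNReal.ofReal_le_ofReal
  linarith

lemma core {z : ℝ → ℂ} {V : NNReal} (hz : LipschitzWith V z) {m : ℝ} (hm : 0 < m)
    (hzm : ∀ t, m ≤ ‖z t‖) {T : ℝ} (hT : 0 < T) :
    ∃ y : ℝ → ℂ, LipschitzWith V y ∧ y 0 = z 0 ∧ y T = z T ∧ (∀ t, ‖y t‖ = ‖z t‖) ∧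
      ∀ s t, s ≤ t → eVariationOn y (Icc s t) = ENNReal.ofReal (V * (t - s)) := by
  have hz0 : ∀ t, 0 < ‖z t‖ := fun t => hm.trans_le (hzm t)
  have hzne : ∀ t, z t ≠ 0 := fun t => norm_pos_iff.1 (hz0 t)
  set C : NNReal := ⟨V / m, by positivity⟩ with hCdef
  have hVC : ∀ t, (V:ℝ) / ‖z t‖ ≤ C := fun t =>
    div_le_div_of_nonneg_left V.coe_nonneg hm (hzm t)
  set q : ℝ → ℂ := fun t => deriv z t / z t with hq
  have hqm : Measurable q := (measurable_deriv z).div hz.continuous.measurable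
  have hqV : ∀ t, ‖q t‖ ≤ V / ‖z t‖ := by
    intro t
    rw [hq]
    simp only [norm_div]
    gcongr
    exact norm_deriv_le_of_lipschitz hz
  have hqC : ∀ t, ‖q t‖ ≤ C := fun t => (hqV t).trans (hVC t)
  have hqI := li_ii (bdd_int hqm.aestronglyMeasurable (ae_of_all _ hqC))
  -- polar representation of `z`
  have hzexp : ∀ t, z t = z 0 * Complex.exp (∫ x in (0:ℝ)..t, q x) := by
    intro t
    have hnC : ∀ t, ‖(-q) t‖ ≤ C := fun t => by simpa using hqC t
    have hac := (hz.lipschitzOnWith.absolutelyContinuousOnInterval (a := 0) (b := t)).smul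
      (exp_ac hqm.neg hnC 0 t)
    obtain ⟨c, hc⟩ := hac.const_of_ae_hasDerivAt_zero (by
      filter_upwards [hz.ae_differentiableAt, exp_deriv hqm.neg hnC] with x h1 h2 _
      have h3 := h1.hasDerivAt.mul h2
      convert! h3 using 1
      simp only [hq, Pi.neg_apply]
      have := hzne x
      field_simp
      ring)
    have c0 := hc 0 left_mem_uIcc
    have ct := hc t right_mem_uIcc
    simp only [Pi.smul_apply', smul_eq_mul, intervalIntegral.integral_same, Pi.neg_apply,
      intervalIntegral.integral_neg, neg_zero, Complex.exp_zero, mul_one] at c0 ct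
    rw [c0, ← ct, mul_assoc, ← Complex.exp_add]
    simp
  set w : ℝ → ℝ := fun t => Real.sqrt ((V / ‖z t‖) ^ 2 - (q t).re ^ 2) with hw
  have hwm : Measurable w := by
    have h1 := hz.continuous.measurable
    have h2 : Measurable fun t => (q t).re := Complex.measurable_re.comp hqm
    fun_prop
  have hsq : ∀ t, (q t).re ^ 2 + (q t).im ^ 2 ≤ (V / ‖z t‖) ^ 2 := by
    intro t
    have h1 := pow_le_pow_left₀ (norm_nonneg _) (hqV t) 2
    rw [Complex.sq_norm, Complex.normSq_apply] at h1
    linarith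
  have hw2 : ∀ t, w t ^ 2 = (V / ‖z t‖) ^ 2 - (q t).re ^ 2 := fun t =>
    Real.sq_sqrt (by nlinarith [hsq t, sq_nonneg (q t).im])
  have hw0 : ∀ t, 0 ≤ w t := fun t => Real.sqrt_nonneg _
  have hwim : ∀ t, |(q t).im| ≤ w t := fun t => Real.abs_le_sqrt (by linarith [hsq t])
  have hwC : ∀ t, ‖w t‖ ≤ C := by
    intro t
    rw [Real.norm_of_nonneg (hw0 t)]
    refine le_trans ?_ (hVC t)
    refine Real.sqrt_le_iff.2 ⟨by positivity, by nlinarith [sq_nonneg (q t).re]⟩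
  have hwI := li_ii (bdd_int hwm.aestronglyMeasurable (ae_of_all _ hwC))
  have hwL := bdd_lip hwm.aestronglyMeasurable (ae_of_all _ hwC)
  have him : ∀ (f : ℝ → ℂ), (∀ a b, IntervalIntegrable f volume a b) → ∀ a b,
      (∫ x in a..b, f x).im = ∫ x in a..b, (f x).im := fun f hf a b =>
    (Complex.imCLM.intervalIntegral_comp_comm (hf a b)).symm
  have hre : ∀ (f : ℝ → ℂ), (∀ a b, IntervalIntegrable f volume a b) → ∀ a b,
      (∫ x in a..b, f x).re = ∫ x in a..b, (f x).re := fun f hf a b =>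
    (Complex.reCLM.intervalIntegral_comp_comm (hf a b)).symm
  -- choice of the switching time
  have hW : |∫ x in (0:ℝ)..T, (q x).im| ≤ ∫ x in (0:ℝ)..T, w x := by
    have := intervalIntegral.norm_integral_le_of_norm_le hT.le
      (ae_of_all _ fun x _ => by simpa using hwim x) (hwI 0 T) (f := fun x => (q x).im)
    simpa using this
  obtain ⟨τ, hτ, hτe⟩ : ∃ τ ∈ Icc (0:ℝ) T,
      2 * (∫ x in (0:ℝ)..τ, w x) - (∫ x in (0:ℝ)..T, w x) = ∫ x in (0:ℝ)..T, (q x).im := by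
    have hcont : ContinuousOn (fun τ => 2 * (∫ x in (0:ℝ)..τ, w x) - (∫ x in (0:ℝ)..T, w x))
        (Icc 0 T) := ((continuous_const.mul hwL.continuous).sub continuous_const).continuousOn
    have hiv := intermediate_value_Icc hT.le hcont
    have hab := abs_le.1 hW
    exact hiv ⟨by simpa using hab.1, by linarith [hab.2]⟩
  set σ : ℝ → ℝ := fun t => if t ≤ τ then w t else - w t with hσ
  have hσm : Measurable σ := Measurable.ite measurableSet_Iic hwm hwm.neg
  have hσ2 : ∀ t, σ t ^ 2 = w t ^ 2 := by
    intro t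
    simp only [hσ]
    split_ifs <;> ring
  set f : ℝ → ℂ := fun t => ⟨(q t).re, σ t⟩ with hf
  have hfn : ∀ t, ‖f t‖ = V / ‖z t‖ := by
    intro t
    have h1 : ‖f t‖ ^ 2 = (V / ‖z t‖) ^ 2 := by
      rw [Complex.sq_norm, Complex.normSq_apply]
      simp only [hf]
      linarith [hσ2 t, hw2 t]
    exact (sq_eq_sq₀ (norm_nonneg _) (by positivity)).1 h1
  have hfC : ∀ t, ‖f t‖ ≤ C := fun t => (hfn t).le.trans (hVC t)
  have hfm : Measurable f := by
    have h2 : Measurable fun t => (q t).re := Complex.measurable_re.comp hqm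
    have : f = fun t => ((q t).re : ℂ) + (σ t : ℂ) * Complex.I := by
      funext t
      apply Complex.ext <;> simp [hf]
    rw [this]
    exact (Complex.measurable_ofReal.comp h2).add
      ((Complex.measurable_ofReal.comp hσm).mul_const _)
  have hfI := li_ii (bdd_int hfm.aestronglyMeasurable (ae_of_all _ hfC))
  have hfq : ∀ t, (∫ x in (0:ℝ)..t, f x).re = (∫ x in (0:ℝ)..t, q x).re := by
    intro t
    rw [hre f hfI, hre q hqI]
  have hfT : ∫ x in (0:ℝ)..T, f x = ∫ x in (0:ℝ)..T, q x := by
    apply Complex.ext (hfq T)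
    rw [him f hfI, him q hqI, ← hτe]
    have hσI : ∀ a b, IntervalIntegrable σ volume a b := by
      refine li_ii (bdd_int hσm.aestronglyMeasurable (C := C) (ae_of_all _ fun t => ?_))
      refine le_trans (le_of_eq ?_) (hwC t)
      simp only [hσ]
      split_ifs <;> simp
    change ∫ x in (0:ℝ)..T, σ x = _
    rw [← intervalIntegral.integral_add_adjacent_intervals (hσI 0 τ) (hσI τ T),
      ← intervalIntegral.integral_add_adjacent_intervals (hwI 0 τ) (hwI τ T)]
    have e1 : ∫ x in (0:ℝ)..τ, σ x = ∫ x in (0:ℝ)..τ, w x := by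
      refine intervalIntegral.integral_congr fun x hx => ?_
      rw [uIcc_of_le hτ.1] at hx
      simp [hσ, hx.2]
    have e2 : ∫ x in τ..T, σ x = - ∫ x in τ..T, w x := by
      rw [← intervalIntegral.integral_neg]
      refine intervalIntegral.integral_congr_ae (ae_of_all _ fun x hx => ?_)
      rw [uIoc_of_le hτ.2] at hx
      simp [hσ, not_le.2 hx.1]
    rw [e1, e2]
    ring
  set y : ℝ → ℂ := fun t => z 0 * Complex.exp (∫ x in (0:ℝ)..t, f x) with hy
  have hyn : ∀ t, ‖y t‖ = ‖z t‖ := by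
    intro t
    rw [hzexp t]
    simp only [hy, norm_mul, Complex.norm_exp, hfq]
  have hyac : ∀ a b, AbsolutelyContinuousOnInterval y a b := fun a b =>
    (exp_ac hfm hfC a b).const_smul (z 0)
  have hyd : ∀ᵐ x, HasDerivAt y (y x * f x) x := by
    filter_upwards [exp_deriv hfm hfC] with x hx
    have := hx.const_mul (z 0)
    rwa [← mul_assoc] at this
  have hnV : ∀ x, ‖y x * f x‖ = V := by
    intro x
    rw [norm_mul, hyn, hfn]
    have := (hz0 x).ne'
    field_simp
  have hyL : LipschitzWith V y := by
    refine lip_of_ac hyac ?_ ?_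
    · filter_upwards [hyd] with x hx using hx.differentiableAt
    · filter_upwards [hyd] with x hx
      rw [hx.deriv, hnV]
  refine ⟨y, hyL, by simp [hy], ?_, hyn, fun s t hst => var_eq hyL ?_ hst⟩
  · rw [hzexp T, ← hfT]
  · filter_upwards [hyd] with x hx using ⟨_, hx, hnV x⟩

/-- **Proposition 2.** If an admissible trajectory of duration `T > 0` from `a` to `b` never
passes through the GBS location `g`, then there is an admissible trajectory of the same
duration from `a` to `b` that travels at constant speed `Vmax` (its arc length over every
subinterval `[s, t]` of `[0, T]` equals `Vmax * (t - s)`) and transmits at least as much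
information. -/
theorem prop2_constant_speed
    (g a b : EuclideanSpace ℝ (Fin 2)) (B γ H Vmax : ℝ)
    (hB : 0 < B) (hγ : 0 < γ) (hH : 0 < H) (hV : 0 < Vmax)
    (T : ℝ) (hT : 0 < T) (u : ℝ → EuclideanSpace ℝ (Fin 2))
    (hu : LipschitzOnWith (Real.toNNReal Vmax) u (Set.Icc 0 T))
    (hu0 : u 0 = a) (huT : u T = b)
    (hg : ∀ t ∈ Set.Icc (0 : ℝ) T, u t ≠ g) :
    ∃ u' : ℝ → EuclideanSpace ℝ (Fin 2),
      LipschitzOnWith (Real.toNNReal Vmax) u' (Set.Icc 0 T) ∧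
      u' 0 = a ∧ u' T = b ∧
      (∀ s t : ℝ, 0 ≤ s → s ≤ t → t ≤ T →
        eVariationOn u' (Set.Icc s t) = ENNReal.ofReal (Vmax * (t - s))) ∧
      (∫ t in (0 : ℝ)..T, rate B γ H g (u t)) ≤ ∫ t in (0 : ℝ)..T, rate B γ H g (u' t) := by
  set e := Complex.orthonormalBasisOneI.repr with he
  set V : NNReal := Real.toNNReal Vmax with hVdef
  have hVc : (V : ℝ) = Vmax := Real.coe_toNNReal _ hV.le
  set z : ℝ → ℂ := fun t => e.symm (u (projIcc 0 T hT.le t) - g) with hzdef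
  have hproj : LipschitzWith 1 (fun t => ((projIcc 0 T hT.le t : Icc (0:ℝ) T) : ℝ)) :=
    LipschitzWith.subtype_val _ |>.comp (LipschitzWith.projIcc hT.le) |>.weaken (by simp)
  have hz : LipschitzWith V z := by
    refine LipschitzWith.of_dist_le_mul fun s t => ?_
    simp only [hzdef, LinearIsometryEquiv.dist_map, dist_sub_right]
    refine (hu.dist_le_mul _ (projIcc 0 T hT.le s).2 _ (projIcc 0 T hT.le t).2).trans ?_
    gcongr
    simpa using hproj.dist_le_mul s t
  have hzn : ∀ t ∈ Icc (0:ℝ) T, z t = e.symm (u t - g) := by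
    intro t ht
    simp only [hzdef, projIcc_of_mem hT.le ht]
  obtain ⟨m, hm, hzm⟩ : ∃ m : ℝ, 0 < m ∧ ∀ t, m ≤ ‖z t‖ := by
    obtain ⟨t₀, ht₀, hmin⟩ := isCompact_Icc.exists_isMinOn (nonempty_Icc.2 hT.le)
      (f := fun t => ‖u t - g‖) (hu.continuousOn.sub continuousOn_const).norm
    refine ⟨‖u t₀ - g‖, norm_pos_iff.2 (sub_ne_zero.2 (hg t₀ ht₀)), fun t => ?_⟩
    simp only [hzdef, LinearIsometryEquiv.norm_map]
    exact hmin (projIcc 0 T hT.le t).2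
  obtain ⟨y, hyL, hy0, hyT, hyn, hyv⟩ := core hz hm hzm hT
  have h0 : (0:ℝ) ∈ Icc (0:ℝ) T := left_mem_Icc.2 hT.le
  have hTm : T ∈ Icc (0:ℝ) T := right_mem_Icc.2 hT.le
  refine ⟨fun t => e (y t) + g, ?_, ?_, ?_, ?_, ?_⟩
  · refine LipschitzWith.lipschitzOnWith (LipschitzWith.of_dist_le_mul fun s t => ?_)
    rw [dist_add_right, LinearIsometryEquiv.dist_map]
    exact hyL.dist_le_mul s t
  · simp [hy0, hzn 0 h0, hu0]
  · simp [hyT, hzn T hTm, huT]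
  · intro s t _ hst _
    rw [← hVc, ← hyv s t hst]
    simp [eVariationOn, edist_dist, dist_add_right]
  · refine le_of_eq (intervalIntegral.integral_congr fun t ht => ?_)
    rw [uIcc_of_le hT.le] at ht
    simp only [rate, add_sub_cancel_right, LinearIsometryEquiv.norm_map, hyn, hzn t ht]
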